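/- arXiv:0907.3754 — 2 statements merged into one kernel-verified Lean document; each statement's English description precedes it below -/
import Mathlib

section
/- Let ε > 0, let F : ℝ^n → ℝ^d be a surjective linear map, let K = F(B₁^n), and let {μ_x} be the K-norm mechanism, i.e., μ_x has Lebesgue density a ↦ Z^{−1}·exp(−ε·‖F x − a‖_K) with Z = ∫ exp(−ε·‖a‖_K) da. Then for every x ∈ ℝ^n and every real p > 0, E_{a∼μ_x} ‖F x − a‖₂^p = (Γ(d+1+p)/(ε^p·Γ(d+1))) · (1/vol(K))·∫_K ‖z‖₂^p dz. In particular, taking p = 1, E_{a∼μ_x} ‖F x − a‖₂ = ((d+1)/ε) · (1/vol(K))·∫_K ‖z‖₂ dz. -/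
open MeasureTheory

section helpers
open Set Topology

variable {d : ℕ}

/-- Scaling of the truncated moments. -/
lemma knorm_scale (g : EuclideanSpace ℝ (Fin d) → ℝ) (hg : Continuous g)
    (hsm : ∀ (t : ℝ), 0 ≤ t → ∀ a, g (t • a) = t * g a) (q : ℝ) (t : ℝ) (ht : 0 < t) :
    ∫⁻ a, {a | g a ≤ t}.indicator (fun a => ENNReal.ofReal (‖a‖ ^ q)) a
      = ENNReal.ofReal (t ^ ((d : ℝ) + q)) *
        ∫⁻ a in {a | g a ≤ 1}, ENNReal.ofReal (‖a‖ ^ q) := by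
  have hS : ∀ t : ℝ, MeasurableSet {a | g a ≤ t} := fun t =>
    (isClosed_le hg continuous_const).measurableSet
  have hm : Measurable (fun a : EuclideanSpace ℝ (Fin d) => ENNReal.ofReal (‖a‖ ^ q)) := by
    fun_prop
  set h : EuclideanSpace ℝ (Fin d) → ENNReal :=
    {a | g a ≤ 1}.indicator (fun a => ENNReal.ofReal (‖a‖ ^ q)) with hh
  have hhm : Measurable h := hm.indicator (hS 1)
  have key : ∀ a, {a | g a ≤ t}.indicator (fun a => ENNReal.ofReal (‖a‖ ^ q)) a
      = ENNReal.ofReal (t ^ q) * h (t⁻¹ • a) := by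
    intro a
    have h1 : g (t⁻¹ • a) ≤ 1 ↔ g a ≤ t := by
      rw [hsm _ (inv_nonneg.2 ht.le), inv_mul_le_iff₀ ht, mul_one]
    by_cases hc : g a ≤ t
    · rw [hh, indicator_of_mem (show a ∈ {a | g a ≤ t} from hc),
        indicator_of_mem (show t⁻¹ • a ∈ {a | g a ≤ 1} from h1.2 hc),
        ← ENNReal.ofReal_mul (Real.rpow_nonneg ht.le _),
        ← Real.mul_rpow ht.le (norm_nonneg _), norm_smul, Real.norm_of_nonneg (inv_nonneg.2 ht.le),
        mul_inv_cancel_left₀ ht.ne']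
    · rw [hh, indicator_of_notMem (show a ∉ {a | g a ≤ t} from hc),
        indicator_of_notMem (show t⁻¹ • a ∉ {a | g a ≤ 1} from fun h => hc (h1.1 h)), mul_zero]
  simp_rw [key]
  rw [lintegral_const_mul _ (by fun_prop)]
  have h2 : ∫⁻ a, h (t⁻¹ • a) = ENNReal.ofReal (t ^ d) * ∫⁻ a, h a := by
    rw [← lintegral_map (f := h) hhm (measurable_const_smul t⁻¹),
      Measure.map_addHaar_smul _ (inv_ne_zero ht.ne'), lintegral_smul_measure]
    simp [abs_of_pos ht]
  rw [h2, ← mul_assoc, ← ENNReal.ofReal_mul (Real.rpow_nonneg ht.le _), hh,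
    lintegral_indicator (hS 1), mul_comm (t ^ q), Real.rpow_add ht, Real.rpow_natCast]

lemma knorm_core (g : EuclideanSpace ℝ (Fin d) → ℝ) (hg : Continuous g) (hg0 : ∀ a, 0 ≤ g a)
    (hsm : ∀ (t : ℝ), 0 ≤ t → ∀ a, g (t • a) = t * g a) (q : ℝ) (hq : 0 ≤ q)
    (ε : ℝ) (hε : 0 < ε) :
    ∫⁻ a, ENNReal.ofReal (‖a‖ ^ q * Real.exp (-ε * g a))
      = ENNReal.ofReal (Real.Gamma ((d : ℝ) + 1 + q) / ε ^ ((d : ℝ) + q)) *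
        ∫⁻ a in {a | g a ≤ 1}, ENNReal.ofReal (‖a‖ ^ q) := by
  have hexp : ∀ s : ℝ, 0 ≤ s → ENNReal.ofReal (Real.exp (-ε * s)) =
      ∫⁻ t in Ioi (0:ℝ), (Ici s).indicator (fun t => ENNReal.ofReal (ε * Real.exp (-ε * t))) t := by
    intro s hs
    rw [lintegral_indicator measurableSet_Ici, Measure.restrict_restrict measurableSet_Ici]
    have e1 : (Ici s ∩ Ioi 0 : Set ℝ) =ᵐ[volume] Ioi s := by
      have : (Ici s ∩ Ioi 0 : Set ℝ) =ᵐ[volume] (Ioi s ∩ Ioi 0 : Set ℝ) :=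
        Ioi_ae_eq_Ici.symm.inter (Filter.EventuallyEq.refl _ _)
      rwa [Ioi_inter_Ioi, sup_eq_left.2 hs] at this
    rw [Measure.restrict_congr_set e1, ← ofReal_integral_eq_lintegral_ofReal]
    · rw [integral_const_mul, integral_exp_mul_Ioi (by linarith)]
      congr 1
      field_simp
    · exact (integrableOn_exp_mul_Ioi (by linarith) s).const_mul ε
    · exact Filter.Eventually.of_forall fun t => by positivity
  have hgam : ∫⁻ t in Ioi (0:ℝ), ENNReal.ofReal (ε * Real.exp (-ε * t)) *
      ENNReal.ofReal (t ^ ((d : ℝ) + q)) =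
      ENNReal.ofReal (Real.Gamma ((d : ℝ) + 1 + q) / ε ^ ((d : ℝ) + q)) := by
    have hd : (0:ℝ) ≤ d := Nat.cast_nonneg d
    have : ∀ t : ℝ, ENNReal.ofReal (ε * Real.exp (-ε * t)) * ENNReal.ofReal (t ^ ((d : ℝ) + q))
        = ENNReal.ofReal (ε * (t ^ ((d : ℝ) + q) * Real.exp (-ε * t))) := by
      intro t
      rw [← ENNReal.ofReal_mul (by positivity)]
      congr 1; ring
    simp_rw [this]
    rw [← ofReal_integral_eq_lintegral_ofReal]
    · have := Real.integral_rpow_mul_exp_neg_mul_Ioi (a := (d:ℝ) + q + 1) (r := ε)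
        (by positivity) hε
      rw [integral_const_mul]
      simp only [add_sub_cancel_right, ← neg_mul] at this
      rw [this, add_right_comm, Real.div_rpow zero_le_one hε.le, Real.one_rpow,
        show (d:ℝ) + 1 + q = (d + q) + 1 by ring, Real.rpow_add hε, Real.rpow_one]
      congr 1
      have := Real.rpow_pos_of_pos hε ((d:ℝ) + q)
      field_simp
    · have := integrableOn_rpow_mul_exp_neg_mul_rpow (p := 1) (s := (d:ℝ) + q) (b := ε)
        (by linarith) one_pos hε
      simp only [Real.rpow_one] at this
      exact this.const_mul ε
    · refine (ae_restrict_iff' measurableSet_Ioi).2 (Filter.Eventually.of_forall fun t ht => ?_)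
      have := Real.rpow_nonneg (le_of_lt (mem_Ioi.1 ht)) ((d:ℝ) + q)
      simp only [Pi.zero_apply]
      positivity
  have hm : Measurable (fun a : EuclideanSpace ℝ (Fin d) => ENNReal.ofReal (‖a‖ ^ q)) := by
    fun_prop
  have hS : MeasurableSet {z : EuclideanSpace ℝ (Fin d) × ℝ | g z.1 ≤ z.2} :=
    (isClosed_le (hg.comp continuous_fst) continuous_snd).measurableSet
  calc ∫⁻ a, ENNReal.ofReal (‖a‖ ^ q * Real.exp (-ε * g a))
      = ∫⁻ a, ∫⁻ t in Ioi (0:ℝ), {z : EuclideanSpace ℝ (Fin d) × ℝ | g z.1 ≤ z.2}.indicator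
          (fun z => ENNReal.ofReal (ε * Real.exp (-ε * z.2)) * ENNReal.ofReal (‖z.1‖ ^ q))
          (a, t) := by
        refine lintegral_congr fun a => ?_
        rw [ENNReal.ofReal_mul (by positivity), hexp _ (hg0 a), ← lintegral_const_mul]
        · refine lintegral_congr fun t => ?_
          by_cases hc : g a ≤ t
          · rw [indicator_of_mem (show t ∈ Ici (g a) from hc), indicator_of_mem (by exact hc),
              mul_comm]
          · rw [indicator_of_notMem (show t ∉ Ici (g a) from hc),
              indicator_of_notMem (by exact hc), mul_zero]
        · exact Measurable.indicator (by fun_prop) measurableSet_Ici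
    _ = ∫⁻ t in Ioi (0:ℝ), ∫⁻ a, {z : EuclideanSpace ℝ (Fin d) × ℝ | g z.1 ≤ z.2}.indicator
          (fun z => ENNReal.ofReal (ε * Real.exp (-ε * z.2)) * ENNReal.ofReal (‖z.1‖ ^ q))
          (a, t) := by
        refine lintegral_lintegral_swap (Measurable.aemeasurable ?_)
        exact Measurable.indicator (by fun_prop) hS
    _ = ∫⁻ t in Ioi (0:ℝ), (ENNReal.ofReal (ε * Real.exp (-ε * t)) *
          ENNReal.ofReal (t ^ ((d : ℝ) + q))) *
            ∫⁻ a in {a | g a ≤ 1}, ENNReal.ofReal (‖a‖ ^ q) := by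
        refine setLIntegral_congr_fun measurableSet_Ioi fun t ht => ?_
        rw [mul_assoc, ← knorm_scale g hg hsm q t ht, ← lintegral_const_mul]
        · refine lintegral_congr fun a => ?_
          by_cases hc : g a ≤ t
          · rw [indicator_of_mem (by exact hc), indicator_of_mem (by exact hc)]
          · rw [indicator_of_notMem (by exact hc), indicator_of_notMem (by exact hc), mul_zero]
        · exact hm.indicator (isClosed_le hg continuous_const).measurableSet
    _ = _ := by
        rw [lintegral_mul_const _ (by fun_prop), hgam]

lemma knorm_core_real (g : EuclideanSpace ℝ (Fin d) → ℝ) (hg : Continuous g) (hg0 : ∀ a, 0 ≤ g a)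
    (hsm : ∀ (t : ℝ), 0 ≤ t → ∀ a, g (t • a) = t * g a) (q : ℝ) (hq : 0 ≤ q)
    (ε : ℝ) (hε : 0 < ε) :
    ∫ a, ‖a‖ ^ q * Real.exp (-ε * g a)
      = Real.Gamma ((d : ℝ) + 1 + q) / ε ^ ((d : ℝ) + q) * ∫ a in {a | g a ≤ 1}, ‖a‖ ^ q := by
  have hG : 0 < Real.Gamma ((d : ℝ) + 1 + q) := Real.Gamma_pos_of_pos (by positivity)
  have hm : Measurable fun a : EuclideanSpace ℝ (Fin d) => ‖a‖ ^ q := by fun_prop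
  rw [integral_eq_lintegral_of_nonneg_ae, integral_eq_lintegral_of_nonneg_ae,
    knorm_core g hg hg0 hsm q hq ε hε, ENNReal.toReal_mul, ENNReal.toReal_ofReal (by positivity)]
  · exact Filter.Eventually.of_forall fun t => by positivity
  · exact hm.aestronglyMeasurable
  · exact Filter.Eventually.of_forall fun t => by positivity
  · exact (hm.mul (by have := hg.measurable; fun_prop)).aestronglyMeasurable

lemma knorm_main (g : EuclideanSpace ℝ (Fin d) → ℝ) (hg : Continuous g) (hg0 : ∀ a, 0 ≤ g a)
    (hsm : ∀ (t : ℝ), 0 ≤ t → ∀ a, g (t • a) = t * g a) (q : ℝ) (hq : 0 ≤ q)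
    (ε : ℝ) (hε : 0 < ε) (Z : ℝ) (hZ : Z = ∫ a, Real.exp (-ε * g a))
    (y : EuclideanSpace ℝ (Fin d)) :
    (∫ a, ‖y - a‖ ^ q ∂ (volume.withDensity
      (fun a => ENNReal.ofReal (Z⁻¹ * Real.exp (-ε * g (y - a)))))) =
        Real.Gamma ((d : ℝ) + 1 + q) / (ε ^ q * Real.Gamma ((d : ℝ) + 1)) *
          ((volume {a | g a ≤ 1}).toReal⁻¹ * ∫ z in {a | g a ≤ 1}, ‖z‖ ^ q) := by
  have hZ0 : 0 ≤ Z := hZ ▸ integral_nonneg fun a => (Real.exp_pos _).le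
  have hZ' : Z = Real.Gamma ((d : ℝ) + 1) / ε ^ (d : ℝ) * (volume {a | g a ≤ 1}).toReal := by
    have := knorm_core_real g hg hg0 hsm 0 le_rfl ε hε
    simp only [Real.rpow_zero, one_mul, add_zero] at this
    rw [hZ, this]
    simp [measureReal_def]
  have hgm := hg.measurable
  rw [integral_withDensity_eq_integral_toReal_smul (by fun_prop)
    (Filter.Eventually.of_forall fun _ => ENNReal.ofReal_lt_top)]
  have h1 : ∀ a, (ENNReal.ofReal (Z⁻¹ * Real.exp (-ε * g (y - a)))).toReal • ‖y - a‖ ^ q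
      = (fun b => Z⁻¹ * (‖b‖ ^ q * Real.exp (-ε * g b))) (y - a) := by
    intro a
    rw [ENNReal.toReal_ofReal (by positivity), smul_eq_mul]
    ring
  simp_rw [h1]
  rw [integral_sub_left_eq_self (fun b => Z⁻¹ * (‖b‖ ^ q * Real.exp (-ε * g b))),
    integral_const_mul, knorm_core_real g hg hg0 hsm q hq ε hε, hZ', Real.rpow_add hε]
  have hG : 0 < Real.Gamma ((d : ℝ) + 1) := Real.Gamma_pos_of_pos (by positivity)
  have := Real.rpow_pos_of_pos hε (d:ℝ)
  have := Real.rpow_pos_of_pos hε q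
  rw [mul_inv, inv_div]
  field_simp

end helpers

/-- Moments of the K-norm mechanism: with `K = F(B₁^n)` and `μ_x` the K-norm
mechanism, for every `p > 0`,
`E_{a∼μ_x} ‖Fx − a‖₂^p = (Γ(d+1+p)/(ε^p Γ(d+1))) · (1/vol K) ∫_K ‖z‖₂^p dz`;
in particular for `p = 1` the error is `((d+1)/ε) · (1/vol K) ∫_K ‖z‖₂ dz`. -/
theorem knorm_mechanism_error (n d : ℕ) (ε : ℝ) (hε : 0 < ε)
    (F : EuclideanSpace ℝ (Fin n) →ₗ[ℝ] EuclideanSpace ℝ (Fin d))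
    (hF : Function.Surjective F)
    (K : Set (EuclideanSpace ℝ (Fin d)))
    (hK : K = F '' {x : EuclideanSpace ℝ (Fin n) | ∑ i, |x i| ≤ 1})
    (Z : ℝ) (hZ : Z = ∫ a : EuclideanSpace ℝ (Fin d), Real.exp (-ε * gauge K a))
    (μ : EuclideanSpace ℝ (Fin n) → Measure (EuclideanSpace ℝ (Fin d)))
    (hμ : ∀ x, μ x = volume.withDensity
      (fun a => ENNReal.ofReal (Z⁻¹ * Real.exp (-ε * gauge K (F x - a)))))
    (x : EuclideanSpace ℝ (Fin n)) (p : ℝ) (hp : 0 < p) :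
    (∫ a, ‖F x - a‖ ^ p ∂ μ x) =
        Real.Gamma ((d : ℝ) + 1 + p) / (ε ^ p * Real.Gamma ((d : ℝ) + 1)) *
          ((volume K).toReal⁻¹ * ∫ z in K, ‖z‖ ^ p) ∧
    (∫ a, ‖F x - a‖ ∂ μ x) =
        ((d : ℝ) + 1) / ε * ((volume K).toReal⁻¹ * ∫ z in K, ‖z‖) := by
  have hB : IsCompact {x : EuclideanSpace ℝ (Fin n) | ∑ i, |x i| ≤ 1} := by
    refine Metric.isCompact_of_isClosed_isBounded
      (isClosed_le (by fun_prop) continuous_const) ?_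
    refine (Metric.isBounded_closedBall (x := (0 : EuclideanSpace ℝ (Fin n))) (r := 1)).subset ?_
    intro x hx
    have hx : ∑ i, |x i| ≤ 1 := hx
    rw [mem_closedBall_zero_iff]
    have h2 : ‖x‖ ^ 2 ≤ 1 := by
      rw [EuclideanSpace.norm_sq_eq]
      refine (Finset.sum_le_sum fun i _ => ?_).trans hx
      have h3 : |x i| ≤ 1 :=
        (Finset.single_le_sum (f := fun i => |x i|) (fun i _ => abs_nonneg _)
          (Finset.mem_univ i)).trans hx
      rw [Real.norm_eq_abs]
      nlinarith [abs_nonneg (x i)]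
    nlinarith [norm_nonneg x]
  have hBc : Convex ℝ {x : EuclideanSpace ℝ (Fin n) | ∑ i, |x i| ≤ 1} := by
    intro x hx y hy a b ha hb hab
    have hx : ∑ i, |x i| ≤ 1 := hx
    have hy : ∑ i, |y i| ≤ 1 := hy
    change ∑ i, |(a • x + b • y) i| ≤ 1
    calc ∑ i, |(a • x + b • y) i| ≤ ∑ i, (a * |x i| + b * |y i|) := by
          refine Finset.sum_le_sum fun i _ => ?_
          simp only [PiLp.add_apply, PiLp.smul_apply, smul_eq_mul]
          refine (abs_add_le _ _).trans (le_of_eq ?_)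
          rw [abs_mul, abs_mul, abs_of_nonneg ha, abs_of_nonneg hb]
      _ = a * ∑ i, |x i| + b * ∑ i, |y i| := by
          rw [Finset.sum_add_distrib, Finset.mul_sum, Finset.mul_sum]
      _ ≤ 1 := by nlinarith
  have hB0 : {x : EuclideanSpace ℝ (Fin n) | ∑ i, |x i| ≤ 1} ∈ nhds 0 := by
    refine Filter.mem_of_superset
      ((isOpen_lt (f := fun x : EuclideanSpace ℝ (Fin n) => ∑ i, |x i|) (g := fun _ => (1:ℝ))
        (by fun_prop) continuous_const).mem_nhds ?_) fun x hx =>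
        show ∑ i, |x i| ≤ 1 from le_of_lt (show ∑ i, |x i| < 1 from hx)
    simp
  have hKc : Convex ℝ K := hK ▸ hBc.linear_image F
  have hKcl : IsClosed K := by
    rw [hK]
    exact (hB.image F.continuous_of_finiteDimensional).isClosed
  have hK0 : K ∈ nhds 0 := by
    have := (F.isOpenMap_of_finiteDimensional hF).image_mem_nhds hB0
    rwa [map_zero, ← hK] at this
  have hset : {a | gauge K a ≤ 1} = K := by
    ext a
    change gauge K a ≤ 1 ↔ _
    rw [gauge_le_one_iff_mem_closure hKc hK0, hKcl.closure_eq]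
  have hsm : ∀ (t : ℝ), 0 ≤ t → ∀ a, gauge K (t • a) = t * gauge K a := fun t ht a => by
    rw [gauge_smul_of_nonneg ht, smul_eq_mul]
  have main := fun q hq => knorm_main (gauge K) (continuous_gauge hKc hK0) gauge_nonneg hsm q hq
    ε hε Z hZ (F x)
  rw [hset, ← hμ x] at main
  refine ⟨main p hp.le, ?_⟩
  have h1 := main 1 zero_le_one
  simp only [Real.rpow_one] at h1
  rw [h1, Real.Gamma_add_one (s := (d:ℝ) + 1) (by positivity)]
  have hG : 0 < Real.Gamma ((d : ℝ) + 1) := Real.Gamma_pos_of_pos (by positivity)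
  congr 1
  field_simp
end

section
/- There exist universal constants c, c′ > 0 such that the following holds. Let d ≥ 2, let F ∈ {−1, 1}^{d×n}, let K = F(B₁^n), and let 0 < ε < c·d·vol(K)^{1/d}/√n. Let M = {μ_x : x ∈ ℤ_{≥0}^n} be a family of probability measures on ℝ^d such that for all nonnegative integer vectors x, y ∈ ℤ_{≥0}^n with ‖x − y‖₁ ≤ 1 and every measurable S ⊆ ℝ^d, μ_x(S) ≤ exp(ε)·μ_y(S). Then sup_{x ∈ ℤ_{≥0}^n} E_{a∼μ_x} ‖a − F x‖₂ ≥ c′·ε^{−1}·d^{3/2}·vol(K)^{1/d}. -/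
open MeasureTheory

/-- The unit ℓ₁-ball in `ℝ^n`. -/
def ballL1 (n : ℕ) : Set (EuclideanSpace ℝ (Fin n)) :=
  {x | ∑ i, |x i| ≤ 1}

/-- A `d × n` matrix applied to a vector of `ℝ^n`, landing in `ℝ^d`. -/
noncomputable def matApply {d n : ℕ} (F : Matrix (Fin d) (Fin n) ℝ)
    (x : EuclideanSpace ℝ (Fin n)) : EuclideanSpace ℝ (Fin d) :=
  (EuclideanSpace.equiv (Fin d) ℝ).symm (F.mulVec (EuclideanSpace.equiv (Fin n) ℝ x))

/-- A nonnegative integer vector viewed as a point of `ℝ^n`. -/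
noncomputable def natVec {n : ℕ} (x : Fin n → ℕ) : EuclideanSpace ℝ (Fin n) :=
  (EuclideanSpace.equiv (Fin n) ℝ).symm (fun i => (x i : ℝ))

lemma round_step {E : Type*} [NormedAddCommGroup E] [InnerProductSpace ℝ E]
    (w f : E) (A D t : ℝ) (hf : ‖f‖ ^ 2 ≤ D) :
    ∃ k : ℤ, A * |(k : ℝ)| + ‖w + ((k : ℝ) - t) • f‖ ^ 2 ≤ A * |t| + ‖w‖ ^ 2 + D := by
  have key : ∀ s : ℝ, ‖w + s • f‖ ^ 2 = ‖w‖ ^ 2 + 2 * s * inner ℝ w f + s ^ 2 * ‖f‖ ^ 2 := by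
    intro s
    rw [norm_add_sq_real, inner_smul_right, norm_smul, mul_pow, Real.norm_eq_abs, sq_abs]
    ring
  by_contra! h
  have h1 := h ⌊t⌋
  have h2 := h (⌊t⌋ + 1)
  rw [key] at h1 h2
  have hp0 := Int.fract_nonneg t
  have hp1 := Int.fract_lt_one t
  have hp : Int.fract t = t - (⌊t⌋ : ℝ) := rfl
  push_cast at h2
  obtain ⟨p, hpd⟩ : ∃ p, p = Int.fract t := ⟨_, rfl⟩
  rw [← hpd] at hp0 hp1 hp
  generalize hk : ((⌊t⌋ : ℤ) : ℝ) = k at *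
  have ht : t = k + p := by linarith
  have habs : |t| = (1 - p) * |k| + p * |k + 1| := by
    rcases le_or_gt 0 ⌊t⌋ with h0 | h0
    · have : 0 ≤ k := by rw [← hk]; exact_mod_cast h0
      rw [abs_of_nonneg this, abs_of_nonneg (by linarith), abs_of_nonneg (by linarith), ht]; ring
    · have : k + 1 ≤ 0 := by rw [← hk]; exact_mod_cast h0
      rw [abs_of_nonpos this, abs_of_nonpos (by linarith : k ≤ 0),
        abs_of_nonpos (by linarith), ht]; ring
  have e1 : k - t = -p := by linarith
  have e2 : k + 1 - t = 1 - p := by linarith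
  rw [e1] at h1
  rw [e2] at h2
  have h3 : (1 - p) * (A * |t| + ‖w‖ ^ 2 + D) + p * (A * |t| + ‖w‖ ^ 2 + D) <
      (1 - p) * (A * |k| + (‖w‖ ^ 2 + 2 * (-p) * inner ℝ w f + (-p) ^ 2 * ‖f‖ ^ 2)) +
      p * (A * |k + 1| + (‖w‖ ^ 2 + 2 * (1 - p) * inner ℝ w f + (1 - p) ^ 2 * ‖f‖ ^ 2)) := by
    have a1 := mul_lt_mul_of_pos_left h1 (by linarith : 0 < 1 - p)
    have a2 := mul_le_mul_of_nonneg_left h2.le hp0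
    linarith
  rw [habs] at h3
  have h4 : D < p * (1 - p) * ‖f‖ ^ 2 := by linarith
  have h5 : p * (1 - p) ≤ 1 := by nlinarith
  have h6 := mul_le_mul_of_nonneg_right h5 (sq_nonneg ‖f‖)
  linarith

lemma round_all {ι E : Type*} [DecidableEq ι] [NormedAddCommGroup E] [InnerProductSpace ℝ E]
    (f : ι → E) (x : ι → ℝ) (A D : ℝ) (hf : ∀ i, ‖f i‖ ^ 2 ≤ D) (s : Finset ι) :
    ∃ z : ι → ℤ, A * ∑ i ∈ s, |(z i : ℝ)| + ‖∑ i ∈ s, ((z i : ℝ) - x i) • f i‖ ^ 2 ≤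
      A * ∑ i ∈ s, |x i| + D * s.card := by
  induction s using Finset.induction_on with
  | empty => exact ⟨0, by simp⟩
  | insert a s ha ih =>
    obtain ⟨z, hz⟩ := ih
    obtain ⟨k, hk⟩ := round_step (∑ i ∈ s, ((z i : ℝ) - x i) • f i) (f a) A D (x a) (hf a)
    refine ⟨Function.update z a k, ?_⟩
    have c1 : ∑ i ∈ s, |((Function.update z a k i : ℤ) : ℝ)| = ∑ i ∈ s, |(z i : ℝ)| := by
      refine Finset.sum_congr rfl fun i hi => ?_
      rw [Function.update_of_ne (by rintro rfl; exact ha hi)]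
    have c2 : ∑ i ∈ s, (((Function.update z a k i : ℤ) : ℝ) - x i) • f i =
        ∑ i ∈ s, ((z i : ℝ) - x i) • f i := by
      refine Finset.sum_congr rfl fun i hi => ?_
      rw [Function.update_of_ne (by rintro rfl; exact ha hi)]
    rw [Finset.sum_insert ha, Finset.sum_insert ha, Finset.sum_insert ha, c1, c2,
      Finset.card_insert_of_notMem ha, Function.update_self, add_comm (_ • f a)]
    push_cast
    linarith

lemma group_privacy {n : ℕ} {Ω : Type*} [MeasurableSpace Ω] (μ : (Fin n → ℕ) → Measure Ω)
    (C : ENNReal)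
    (h : ∀ x y : Fin n → ℕ, (∑ i, |(x i : ℝ) - (y i : ℝ)|) ≤ 1 →
      ∀ S : Set Ω, MeasurableSet S → μ x S ≤ C * μ y S)
    (S : Set Ω) (hS : MeasurableSet S) (y : Fin n → ℕ) (L : ℕ) :
    ∀ x : Fin n → ℕ, (∑ i, |(x i : ℤ) - (y i : ℤ)|) = L → μ x S ≤ C ^ L * μ y S := by
  induction L with
  | zero =>
    intro x hx
    have : x = y := by
      funext i
      have := (Finset.sum_eq_zero_iff_of_nonneg (fun i _ => abs_nonneg _)).1 hx i (Finset.mem_univ i)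
      have := abs_eq_zero.1 this
      omega
    simp [this]
  | succ L ih =>
    intro x hx
    obtain ⟨i, hi⟩ : ∃ i, x i ≠ y i := by
      by_contra! hc
      simp [hc] at hx
      omega
    obtain ⟨v, hv1, hv2⟩ : ∃ v : ℕ, |(v : ℤ) - y i| = |(x i : ℤ) - y i| - 1 ∧
        |(x i : ℤ) - v| = 1 := by
      rcases lt_or_gt_of_ne hi with hlt | hlt
      · refine ⟨x i + 1, ?_, ?_⟩ <;> push_cast <;> grind
      · refine ⟨x i - 1, ?_, ?_⟩ <;> grind
    have s1 : (∑ j, |((Function.update x i v j : ℕ) : ℤ) - (y j : ℤ)|) = L := by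
      rw [← Finset.add_sum_erase _ _ (Finset.mem_univ i)] at hx ⊢
      have : ∑ j ∈ Finset.univ.erase i, |((Function.update x i v j : ℕ) : ℤ) - (y j : ℤ)| =
          ∑ j ∈ Finset.univ.erase i, |(x j : ℤ) - (y j : ℤ)| := by
        refine Finset.sum_congr rfl fun j hj => ?_
        rw [Function.update_of_ne (Finset.ne_of_mem_erase hj)]
      rw [this, Function.update_self, hv1]
      push_cast at hx
      linarith
    have s2 : (∑ j, |(x j : ℝ) - ((Function.update x i v j : ℕ) : ℝ)|) ≤ 1 := by
      rw [Finset.sum_eq_single i]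
      · rw [Function.update_self]
        have : |(x i : ℝ) - v| = 1 := by exact_mod_cast hv2
        exact this.le
      · intro j _ hj
        rw [Function.update_of_ne hj]; simp
      · simp
    calc μ x S ≤ C * μ (Function.update x i v) S := h _ _ s2 S hS
      _ ≤ C * (C ^ L * μ y S) := by gcongr; exact ih _ s1
      _ = C ^ (L + 1) * μ y S := by ring

lemma volume_closedBall_le {d : ℕ} (hd : 1 ≤ d) (R : ℝ) (hR : 0 < R) :
    volume (Metric.closedBall (0 : EuclideanSpace ℝ (Fin d)) R) ≤
      ENNReal.ofReal ((Real.exp 1 * Real.sqrt Real.pi * R / Real.sqrt d) ^ d) := by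
  have hd0 : (0 : ℝ) < d := by exact_mod_cast hd
  set b : ℝ := d / R ^ 2 with hb
  have hbp : 0 < b := by positivity
  have hI := GaussianFourier.integral_rexp_neg_mul_sq_norm (V := EuclideanSpace ℝ (Fin d)) hbp
  have hpos : 0 < ∫ v : EuclideanSpace ℝ (Fin d), Real.exp (-b * ‖v‖ ^ 2) := by
    rw [hI]; positivity
  have hint : Integrable (fun v : EuclideanSpace ℝ (Fin d) => Real.exp (-b * ‖v‖ ^ 2)) := by
    by_contra hc
    rw [integral_undef hc] at hpos
    exact lt_irrefl _ hpos
  have h1 : ENNReal.ofReal (Real.exp (-d)) *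
      volume (Metric.closedBall (0 : EuclideanSpace ℝ (Fin d)) R) ≤
      ENNReal.ofReal (∫ v : EuclideanSpace ℝ (Fin d), Real.exp (-b * ‖v‖ ^ 2)) := by
    rw [ofReal_integral_eq_lintegral_ofReal hint (Filter.Eventually.of_forall fun v => (Real.exp_pos _).le)]
    refine le_trans ?_ (mul_meas_ge_le_lintegral₀ hint.aemeasurable.ennreal_ofReal
      (ENNReal.ofReal (Real.exp (-d))))
    gcongr
    intro v hv
    have hv' : ‖v‖ ≤ R := by simpa using hv
    have : ‖v‖ ^ 2 ≤ R ^ 2 := by gcongr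
    have h2 : b * ‖v‖ ^ 2 ≤ d := by
      calc b * ‖v‖ ^ 2 ≤ b * R ^ 2 := by gcongr
        _ = (d : ℝ) := by rw [hb]; field_simp
    show ENNReal.ofReal _ ≤ ENNReal.ofReal _
    apply ENNReal.ofReal_le_ofReal
    apply Real.exp_le_exp.2
    linarith
  have h3 : (∫ v : EuclideanSpace ℝ (Fin d), Real.exp (-b * ‖v‖ ^ 2)) =
      (Real.sqrt Real.pi * R / Real.sqrt d) ^ d := by
    rw [hI, finrank_euclideanSpace_fin]
    have : Real.pi / b = (Real.sqrt Real.pi * R / Real.sqrt d) ^ 2 := by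
      rw [div_pow, mul_pow, Real.sq_sqrt Real.pi_pos.le, Real.sq_sqrt hd0.le, hb]
      field_simp
    rw [this, ← Real.rpow_natCast _ 2, ← Real.rpow_mul (by positivity), ← Real.rpow_natCast _ d]
    congr 1
    push_cast
    ring
  rw [h3] at h1
  have h4 : volume (Metric.closedBall (0 : EuclideanSpace ℝ (Fin d)) R) =
      ENNReal.ofReal (Real.exp d) * (ENNReal.ofReal (Real.exp (-d)) *
      volume (Metric.closedBall (0 : EuclideanSpace ℝ (Fin d)) R)) := by
    rw [← mul_assoc, ← ENNReal.ofReal_mul (Real.exp_pos _).le, ← Real.exp_add]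
    simp
  rw [h4]
  refine (mul_le_mul_right h1 _).trans ?_
  rw [← ENNReal.ofReal_mul (Real.exp_pos _).le]
  apply ENNReal.ofReal_le_ofReal
  apply le_of_eq
  rw [← mul_one (d : ℝ), mul_comm (d : ℝ) 1, ← Real.rpow_natCast, ← Real.rpow_natCast,
    Real.exp_mul, ← Real.mul_rpow (Real.exp_pos _).le (by positivity)]
  simp
  ring_nf

lemma fubini_ball {d : ℕ} (m : Measure (EuclideanSpace ℝ (Fin d))) [IsProbabilityMeasure m]
    (p : EuclideanSpace ℝ (Fin d)) (R : ℝ) (q : ENNReal) (T : Set (EuclideanSpace ℝ (Fin d)))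
    (hT : ∀ y ∈ T, q ≤ m (Metric.closedBall (p + y) R)) :
    q * volume T ≤ volume (Metric.closedBall (0 : EuclideanSpace ℝ (Fin d)) R) := by
  set s : Set (EuclideanSpace ℝ (Fin d) × EuclideanSpace ℝ (Fin d)) :=
    {z | ‖z.2 - (p + z.1)‖ ≤ R} with hs
  have hsm : MeasurableSet s := by
    apply IsClosed.measurableSet
    exact isClosed_le (by fun_prop) continuous_const
  have e1 : ∀ y, Prod.mk y ⁻¹' s = Metric.closedBall (p + y) R := by
    intro y; ext a; simp [hs, dist_eq_norm]
  have e2 : ∀ a, (fun y => (y, a)) ⁻¹' s = Metric.closedBall (a - p) R := by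
    intro a; ext y
    simp only [hs, Set.mem_preimage, Set.mem_ofPred_eq, Metric.mem_closedBall, dist_eq_norm]
    rw [← norm_neg]
    have : -(a - (p + y)) = y - (a - p) := by abel
    rw [this]
  have hmeas : Measurable fun y => m (Prod.mk y ⁻¹' s) := measurable_measure_prodMk_left hsm
  calc q * volume T ≤ q * volume {y | q ≤ m (Prod.mk y ⁻¹' s)} := by
        gcongr
        intro y hy
        simpa [e1] using hT y hy
    _ ≤ ∫⁻ y, m (Prod.mk y ⁻¹' s) := mul_meas_ge_le_lintegral hmeas q
    _ = (volume.prod m) s := (Measure.prod_apply hsm).symm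
    _ = ∫⁻ a, volume ((fun y => (y, a)) ⁻¹' s) ∂m := Measure.prod_apply_symm hsm
    _ = _ := by
      simp only [e2, Measure.addHaar_closedBall_center]
      simp

lemma matApply_eq_sum {d n : ℕ} (F : Matrix (Fin d) (Fin n) ℝ) (x : EuclideanSpace ℝ (Fin n)) :
    matApply F x = ∑ i, x i • (WithLp.toLp 2 (fun j => F j i) : EuclideanSpace ℝ (Fin d)) := by
  ext j
  simp [matApply, Matrix.mulVec, dotProduct, mul_comm]

lemma col_norm_sq {d n : ℕ} (F : Matrix (Fin d) (Fin n) ℝ) (hF : ∀ i j, F i j = 1 ∨ F i j = -1)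
    (i : Fin n) : ‖(WithLp.toLp 2 (fun j => F j i) : EuclideanSpace ℝ (Fin d))‖ ^ 2 ≤ d := by
  rw [EuclideanSpace.norm_sq_eq]
  have : ∀ j, F j i ^ 2 = 1 := by
    intro j
    rcases hF j i with h | h <;> simp [h]
  simp [this]

lemma exists_round {d n : ℕ} (hd : 1 ≤ d) (hn : 1 ≤ n) (F : Matrix (Fin d) (Fin n) ℝ)
    (hF : ∀ i j, F i j = 1 ∨ F i j = -1) (l : ℝ) (hl : 0 < l) (x : EuclideanSpace ℝ (Fin n))
    (hx : ∑ i, |x i| ≤ l) :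
    ∃ z : Fin n → ℤ, ∑ i, |(z i : ℝ)| ≤ 2 * l ∧
      ‖(∑ i, (z i : ℝ) • (WithLp.toLp 2 (fun j => F j i) : EuclideanSpace ℝ (Fin d)))
        - matApply F x‖ ≤ Real.sqrt (2 * d * n) := by
  have hd0 : (0 : ℝ) < d := by exact_mod_cast hd
  have hn0 : (0 : ℝ) < n := by exact_mod_cast hn
  have hA : (0 : ℝ) < d * n / l := by positivity
  obtain ⟨z, hz⟩ := round_all (fun i => (WithLp.toLp 2 (fun j => F j i) : EuclideanSpace ℝ (Fin d)))
    x (d * n / l) d (col_norm_sq F hF) Finset.univ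
  have h1 : d * n / l * ∑ i, |x i| ≤ d * n := by
    calc d * n / l * ∑ i, |x i| ≤ d * n / l * l := by gcongr
      _ = d * n := by field_simp
  have hcard : ((Finset.univ : Finset (Fin n)).card : ℝ) = n := by simp
  rw [hcard] at hz
  refine ⟨z, ?_, ?_⟩
  · have h2 : d * n / l * ∑ i, |(z i : ℝ)| ≤ d * n / l * (2 * l) := by
      have : d * n / l * (2 * l) = 2 * (d * n) := by field_simp
      rw [this]
      nlinarith [sq_nonneg ‖∑ i, ((z i : ℝ) - x i) •
        (WithLp.toLp 2 (fun j => F j i) : EuclideanSpace ℝ (Fin d))‖]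
    exact le_of_mul_le_mul_left h2 hA
  · rw [matApply_eq_sum, ← Finset.sum_sub_distrib]
    simp only [← sub_smul]
    apply Real.le_sqrt_of_sq_le
    have : 0 ≤ d * n / l * ∑ i, |(z i : ℝ)| := by positivity
    linarith

open scoped Pointwise in
/-- The core inequality. -/
lemma core_bound {d n : ℕ} (hd : 1 ≤ d) (hn : 1 ≤ n) (F : Matrix (Fin d) (Fin n) ℝ)
    (hF : ∀ i j, F i j = 1 ∨ F i j = -1) (ε : ℝ) (hε : 0 < ε)
    (μ : (Fin n → ℕ) → Measure (EuclideanSpace ℝ (Fin d)))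
    (hμ : ∀ x, IsProbabilityMeasure (μ x))
    (hp : ∀ x y : Fin n → ℕ, (∑ i, |(x i : ℝ) - (y i : ℝ)|) ≤ 1 →
      ∀ S : Set (EuclideanSpace ℝ (Fin d)), MeasurableSet S →
        μ x S ≤ ENNReal.ofReal (Real.exp ε) * μ y S)
    (T : ℝ) (hT : 0 < T)
    (herr : ∀ x, ∫⁻ a, ‖a - matApply F (natVec x)‖₊ ∂ μ x ≤ ENNReal.ofReal T) :
    ENNReal.ofReal (Real.exp (-(2 * d)) / 2) *
      volume ((d / ε : ℝ) • (matApply F '' ballL1 n)) ≤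
      volume (Metric.closedBall (0 : EuclideanSpace ℝ (Fin d)) (2 * T + Real.sqrt (2 * d * n))) := by
  have hd0 : (0 : ℝ) < d := by exact_mod_cast hd
  set l : ℝ := d / ε with hl
  have hl0 : 0 < l := by positivity
  set N : ℕ := ⌈2 * l⌉₊ with hN
  have hN' : 2 * l ≤ N := Nat.le_ceil _
  set x0 : Fin n → ℕ := fun _ => N with hx0
  have := hμ x0
  apply fubini_ball (μ x0) (matApply F (natVec x0))
  rintro y ⟨_, ⟨x, hx, rfl⟩, rfl⟩
  have hx' : ∑ i, |(l • x) i| ≤ l := by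
    have : ∑ i, |(l • x) i| = l * ∑ i, |x i| := by
      rw [Finset.mul_sum]
      refine Finset.sum_congr rfl fun i _ => ?_
      simp [abs_mul, abs_of_pos hl0]
    rw [this]
    have hx1 : ∑ i, |x i| ≤ 1 := hx
    nlinarith
  obtain ⟨z, hz1, hz2⟩ := exists_round hd hn F hF l hl0 (l • x) hx'
  have hzN : ∀ i, 0 ≤ (N : ℤ) + z i := by
    intro i
    have h1 : |(z i : ℝ)| ≤ N := by
      refine le_trans ?_ (hz1.trans hN')
      exact Finset.single_le_sum (f := fun i => |(z i : ℝ)|) (fun i _ => abs_nonneg _)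
        (Finset.mem_univ i)
    have h2 : (0 : ℝ) ≤ (N : ℝ) + z i := by linarith [neg_abs_le (z i : ℝ)]
    exact_mod_cast h2
  choose x1 hx1 using fun i => Int.eq_ofNat_of_zero_le (hzN i)
  have hx1r : ∀ i, (x1 i : ℝ) = N + z i := by
    intro i
    have := hx1 i
    have h2 : (x1 i : ℤ) = N + z i := by rw [this]
    exact_mod_cast h2
  have hmat : matApply F (natVec x1) = matApply F (natVec x0) +
      ∑ i, (z i : ℝ) • (WithLp.toLp 2 (fun j => F j i) : EuclideanSpace ℝ (Fin d)) := by
    rw [matApply_eq_sum, matApply_eq_sum, ← Finset.sum_add_distrib]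
    refine Finset.sum_congr rfl fun i _ => ?_
    rw [← add_smul]
    simp [natVec, hx1r, hx0]
  have hlin : matApply F (l • x) = l • matApply F x := by
    rw [matApply_eq_sum, matApply_eq_sum, Finset.smul_sum]
    refine Finset.sum_congr rfl fun i _ => ?_
    simp [mul_smul]
  have hsub : Metric.closedBall (matApply F (natVec x1)) (2 * T) ⊆
      Metric.closedBall (matApply F (natVec x0) + l • matApply F x)
        (2 * T + Real.sqrt (2 * d * n)) := by
    apply Metric.closedBall_subset_closedBall'
    rw [hmat, dist_add_left, dist_eq_norm, ← hlin]
    linarith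
  have hhalf : ENNReal.ofReal (1 / 2) ≤ μ x1 (Metric.closedBall (matApply F (natVec x1)) (2 * T)) := by
    have := hμ x1
    have hm : μ x1 (Metric.closedBall (matApply F (natVec x1)) (2 * T))ᶜ ≤ ENNReal.ofReal (1 / 2) := by
      have hmk := mul_meas_ge_le_lintegral₀ (μ := μ x1)
        (f := fun a => (‖a - matApply F (natVec x1)‖₊ : ENNReal)) (by fun_prop)
        (ENNReal.ofReal (2 * T))
      have h2 : ENNReal.ofReal (2 * T) *
          μ x1 (Metric.closedBall (matApply F (natVec x1)) (2 * T))ᶜ ≤ ENNReal.ofReal T := by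
        refine le_trans ?_ (hmk.trans (herr x1))
        gcongr
        intro a ha
        have ha' : 2 * T < ‖a - matApply F (natVec x1)‖ := by
          simpa [dist_eq_norm] using ha
        show ENNReal.ofReal (2 * T) ≤ (‖a - matApply F (natVec x1)‖₊ : ENNReal)
        rw [← enorm_eq_nnnorm, ← ofReal_norm_eq_enorm]
        exact ENNReal.ofReal_le_ofReal ha'.le
      have h3 : ENNReal.ofReal T = ENNReal.ofReal (2 * T) * ENNReal.ofReal (1 / 2) := by
        rw [← ENNReal.ofReal_mul (by positivity)]
        congr 1; ring
      rw [h3] at h2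
      exact (ENNReal.mul_le_mul_iff_right (by simpa using hT) ENNReal.ofReal_ne_top).1 h2
    have hc := prob_add_prob_compl (μ := μ x1)
      (Metric.isClosed_closedBall (x := matApply F (natVec x1)) (ε := 2 * T)).measurableSet
    by_contra! hlt
    have : μ x1 (Metric.closedBall (matApply F (natVec x1)) (2 * T)) +
        μ x1 (Metric.closedBall (matApply F (natVec x1)) (2 * T))ᶜ <
        ENNReal.ofReal (1 / 2) + ENNReal.ofReal (1 / 2) :=
      ENNReal.add_lt_add_of_lt_of_le (measure_ne_top _ _) hlt hm
    rw [hc, ← ENNReal.ofReal_add (by norm_num) (by norm_num)] at this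
    norm_num at this
  obtain ⟨L, hL⟩ := Int.eq_ofNat_of_zero_le
    (Finset.sum_nonneg (fun i (_ : i ∈ Finset.univ) => abs_nonneg ((x1 i : ℤ) - (x0 i : ℤ))))
  have hLr : (L : ℝ) ≤ 2 * l := by
    have h1 : (((∑ i, |(x1 i : ℤ) - (x0 i : ℤ)| : ℤ)) : ℝ) = (L : ℝ) := by rw [hL]; simp
    rw [← h1]
    push_cast
    simpa [hx1r, hx0] using hz1
  have hgp := group_privacy μ _ hp _
    (Metric.isClosed_closedBall (x := matApply F (natVec x1)) (ε := 2 * T)).measurableSet x0 L x1 hL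
  have hpow : ENNReal.ofReal (Real.exp ε) ^ L ≤ ENNReal.ofReal (Real.exp (2 * d)) := by
    rw [← ENNReal.ofReal_pow (Real.exp_pos _).le, ← Real.exp_nat_mul]
    apply ENNReal.ofReal_le_ofReal
    apply Real.exp_le_exp.2
    calc (L : ℝ) * ε ≤ 2 * l * ε := by gcongr
      _ = 2 * d := by rw [hl]; field_simp
  calc ENNReal.ofReal (Real.exp (-(2 * d)) / 2)
      = ENNReal.ofReal (Real.exp (-(2 * d))) * ENNReal.ofReal (1 / 2) := by
        rw [← ENNReal.ofReal_mul (Real.exp_pos _).le]; congr 1; ring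
    _ ≤ ENNReal.ofReal (Real.exp (-(2 * d))) * (ENNReal.ofReal (Real.exp (2 * d)) *
        μ x0 (Metric.closedBall (matApply F (natVec x1)) (2 * T))) := by
        gcongr
        exact hhalf.trans (hgp.trans (by gcongr))
    _ = μ x0 (Metric.closedBall (matApply F (natVec x1)) (2 * T)) := by
        rw [← mul_assoc, ← ENNReal.ofReal_mul (Real.exp_pos _).le, ← Real.exp_add]
        simp
    _ ≤ _ := measure_mono hsub

lemma const_bound : 2 * Real.exp 3 * Real.sqrt Real.pi * (7 / 2000) < 1 := by
  have h1 : Real.exp 3 < 2.72 ^ 3 := by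
    have : Real.exp 3 = Real.exp 1 ^ 3 := by rw [← Real.exp_nat_mul]; norm_num
    rw [this]
    have := Real.exp_one_lt_d9
    have h0 := Real.exp_pos 1
    gcongr
    linarith
  have h2 : Real.sqrt Real.pi < 2 := by
    rw [Real.sqrt_lt' (by norm_num)]
    linarith [Real.pi_lt_four]
  have h3 := Real.exp_pos 3
  have h4 := Real.sqrt_nonneg Real.pi
  have h5 : Real.exp 3 * Real.sqrt Real.pi ≤ 2.72 ^ 3 * 2 := by gcongr
  norm_num at h5 ⊢
  linarith

/-- Lower bound for differential privacy with respect to Hamming distance: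
there are universal constants `c, c' > 0` such that for every sign matrix
`F ∈ {−1,1}^{d×n}` with `K = F(B₁^n)`, every `0 < ε < c·d·vol(K)^{1/d}/√n`, and
every mechanism on nonnegative-integer histograms that is ε-differentially
private for ℓ₁ (Hamming) distance `≤ 1`, the error is at least
`c'·ε⁻¹·d^{3/2}·vol(K)^{1/d}`. -/
theorem hamming_lower_bound :
    ∃ c c' : ℝ, 0 < c ∧ 0 < c' ∧
      ∀ (n d : ℕ), 2 ≤ d →
        ∀ F : Matrix (Fin d) (Fin n) ℝ, (∀ i j, F i j = 1 ∨ F i j = -1) →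
          ∀ ε : ℝ, 0 < ε →
            ε < c * d * (volume (matApply F '' ballL1 n)).toReal ^ (1 / (d : ℝ)) /
                Real.sqrt n →
            ∀ μ : (Fin n → ℕ) → Measure (EuclideanSpace ℝ (Fin d)),
              (∀ x, IsProbabilityMeasure (μ x)) →
              (∀ x y : Fin n → ℕ, (∑ i, |(x i : ℝ) - (y i : ℝ)|) ≤ 1 →
                ∀ S : Set (EuclideanSpace ℝ (Fin d)), MeasurableSet S →
                  μ x S ≤ ENNReal.ofReal (Real.exp ε) * μ y S) →
              ENNReal.ofReal (c' * ε⁻¹ * (d : ℝ) ^ ((3 : ℝ) / 2) *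
                  (volume (matApply F '' ballL1 n)).toReal ^ (1 / (d : ℝ)))
                ≤ ⨆ x : Fin n → ℕ, ∫⁻ a, ‖a - matApply F (natVec x)‖₊ ∂ μ x := by
  refine ⟨1 / 1000, 1 / 1000, by norm_num, by norm_num, ?_⟩
  intro n d hd F hF ε hε hεlt μ hμ hp
  have hd0 : (0 : ℝ) < d := by exact_mod_cast (by omega : 0 < d)
  set W := (volume (matApply F '' ballL1 n)).toReal with hW
  set V := W ^ (1 / (d : ℝ)) with hV
  have hW0 : 0 ≤ W := ENNReal.toReal_nonneg
  have hV0 : 0 ≤ V := by positivity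
  have hpos := hε.trans hεlt
  have hn : 1 ≤ n := by
    by_contra hc
    have : n = 0 := by omega
    rw [this] at hpos
    simp at hpos
  have hn0 : (0 : ℝ) < n := by exact_mod_cast hn
  have hsn : 0 < Real.sqrt n := Real.sqrt_pos.2 hn0
  have hVpos : 0 < V := by
    rcases hV0.eq_or_lt with h | h
    · rw [← h] at hpos; simp at hpos
    · exact h
  have hWpos : 0 < W := by
    rcases hW0.eq_or_lt with h | h
    · rw [hV, ← h, Real.zero_rpow (by positivity)] at hVpos
      exact absurd hVpos (lt_irrefl _)
    · exact h
  have hVd : V ^ d = W := by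
    rw [hV, ← Real.rpow_natCast, ← Real.rpow_mul hW0]
    rw [one_div_mul_cancel hd0.ne', Real.rpow_one]
  have hvol : volume (matApply F '' ballL1 n) = ENNReal.ofReal (V ^ d) := by
    rw [hVd, hW, ENNReal.ofReal_toReal]
    intro htop
    rw [hW, htop] at hWpos
    simp at hWpos
  have hsd : 0 < Real.sqrt d := Real.sqrt_pos.2 hd0
  have hd32 : (d : ℝ) ^ ((3 : ℝ) / 2) = d * Real.sqrt d := by
    rw [Real.sqrt_eq_rpow, ← Real.rpow_one_add' hd0.le (by norm_num)]
    norm_num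
  rw [hd32]
  set Q : ℝ := d / ε * V * Real.sqrt d with hQ
  have hQ0 : 0 < Q := by positivity
  have hTQ : 1 / 1000 * ε⁻¹ * (d * Real.sqrt d) * V = Q / 1000 := by
    rw [hQ]; field_simp
  rw [hTQ]
  by_contra! hlt
  have hcore := core_bound (by omega) hn F hF ε hε μ hμ hp (Q / 1000) (by positivity)
    (fun x => (le_iSup (fun x => ∫⁻ a, ‖a - matApply F (natVec x)‖₊ ∂ μ x) x).trans hlt.le)
  set R := 2 * (Q / 1000) + Real.sqrt (2 * d * n) with hR
  have hR0 : 0 < R := by positivity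
  have h1 := hcore.trans (volume_closedBall_le (by omega) R hR0)
  rw [Measure.addHaar_smul, finrank_euclideanSpace_fin, hvol,
    ← ENNReal.ofReal_mul (by positivity), ← ENNReal.ofReal_mul (by positivity),
    ENNReal.ofReal_le_ofReal_iff (by positivity), abs_of_pos (by positivity)] at h1
  have h2 : (Real.exp (-2) / 2 * (d / ε * V)) ^ d ≤
      (Real.exp 1 * Real.sqrt Real.pi * R / Real.sqrt d) ^ d := by
    refine le_trans ?_ h1
    rw [mul_pow, div_pow, mul_pow, ← Real.exp_nat_mul]
    have e : (d : ℝ) * -2 = -(2 * d) := by ring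
    rw [e]
    have : (2 : ℝ) ≤ 2 ^ d := le_self_pow₀ (by norm_num) (by omega)
    gcongr
  have h3 := le_of_pow_le_pow_left₀ (by omega : d ≠ 0) (by positivity) h2
  rw [le_div_iff₀ hsd] at h3
  have h4 : Q ≤ 2 * Real.exp 3 * Real.sqrt Real.pi * R := by
    have e3 : Real.exp 3 = Real.exp 2 * Real.exp 1 := by rw [← Real.exp_add]; norm_num
    have em : Real.exp 2 * Real.exp (-2) = 1 := by rw [← Real.exp_add]; simp
    have h5 := mul_le_mul_of_nonneg_left h3 (Real.exp_pos 2).le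
    have h6 : Real.exp 2 * (Real.exp (-2) / 2 * (d / ε * V) * Real.sqrt d) = Q / 2 := by
      rw [hQ]; linear_combination (d / ε * V * Real.sqrt d / 2) * em
    rw [h6] at h5
    rw [e3]
    linarith
  have h7 : R ≤ 7 / 2000 * Q := by
    have h8 : Real.sqrt (2 * d * n) ≤ 3 / 2000 * Q := by
      have a1 : Real.sqrt (2 * d * n) = Real.sqrt 2 * Real.sqrt d * Real.sqrt n := by
        rw [Real.sqrt_mul (by positivity), Real.sqrt_mul (by positivity)]
      have a2 : Real.sqrt 2 ≤ 3 / 2 := by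
        rw [Real.sqrt_le_left (by norm_num)]; norm_num
      have a3 : Real.sqrt n ≤ 1 / 1000 * (d / ε * V) := by
        rw [lt_div_iff₀ hsn] at hεlt
        have : Real.sqrt n ≤ 1 / 1000 * d * V / ε := by
          rw [le_div_iff₀ hε]; linarith
        refine this.trans (le_of_eq ?_)
        ring
      rw [a1, hQ]
      calc Real.sqrt 2 * Real.sqrt d * Real.sqrt n
          ≤ 3 / 2 * Real.sqrt d * (1 / 1000 * (d / ε * V)) := by gcongr
        _ = _ := by ring
    rw [hR]; linarith
  have h9 : Q ≤ 2 * Real.exp 3 * Real.sqrt Real.pi * (7 / 2000 * Q) := h4.trans (by gcongr)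
  nlinarith [const_bound]
end
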